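/- arXiv:alg-geom/9705013 — 2 statements merged into one kernel-verified Lean document; each statement's English description precedes it below -/
import Mathlib

section
/- Let k ∈ ℕ, let α < β, and suppose u ⋖_k (α,β)u is a cover in the k-Bruhat order with (α,β)u ≤_k w. If y ≤_k z and wu⁻¹ = zy⁻¹, then y ⋖_k (α,β)y is a cover in the k-Bruhat order and (α,β)y ≤_k z. -/
/-- A permutation of the positive integers belongs to `S_∞` when it moves only
finitely many points. -/
def FinSupp (w : Equiv.Perm ℕ+) : Prop := {x : ℕ+ | w x ≠ x}.Finite

/-- The length `ℓ(w)` of a permutation: its number of inversions, i.e. of pairs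
`i < j` with `w i > w j`. -/
noncomputable def len (w : Equiv.Perm ℕ+) : ℕ :=
  Set.ncard {p : ℕ+ × ℕ+ | p.1 < p.2 ∧ w p.2 < w p.1}

/-- Covering relation of the `k`-Bruhat order: `u ⋖_k u(a,b)` for `a ≤ k < b`
with `ℓ(u(a,b)) = ℓ(u) + 1`.  Here `u(a,b) = u * (swap a b)`. -/
def kBruhatCov (k : ℕ+) (u w : Equiv.Perm ℕ+) : Prop :=
  ∃ a b : ℕ+, a ≤ k ∧ k < b ∧ w = u * Equiv.swap a b ∧ len w = len u + 1

/-- The `k`-Bruhat order `u ≤_k w`: a chain of `k`-Bruhat covers from `u` to `w`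
(or `u = w`). -/
def kBruhat (k : ℕ+) : Equiv.Perm ℕ+ → Equiv.Perm ℕ+ → Prop :=
  Relation.ReflTransGen (kBruhatCov k)

/-- The set of inversions of a permutation. -/
def inversions (w : Equiv.Perm ℕ+) : Set (ℕ+ × ℕ+) :=
  {p | p.1 < p.2 ∧ w p.2 < w p.1}

theorem FinSupp.finite_inversions {w : Equiv.Perm ℕ+} (hw : FinSupp w) :
    (inversions w).Finite := by
  obtain ⟨N, hN⟩ := hw.bddAbove
  have hfix : ∀ x, N < x → w x = x := fun x hx => by
    by_contra h
    exact absurd (hN h) (not_le.mpr hx)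
  refine ((Set.finite_Iic N).prod (Set.finite_Iic N)).subset ?_
  rintro ⟨p, q⟩ ⟨hpq, hw'⟩
  simp only at hpq hw'
  have hq : q ≤ N := by
    by_contra! hq
    rw [hfix q hq] at hw'
    have hp := hfix (w p) (hq.trans hw')
    have := w.injective hp
    order
  exact ⟨hpq.le.trans hq, hq⟩

theorem FinSupp.mul_swap {w : Equiv.Perm ℕ+} (hw : FinSupp w) (a b : ℕ+) :
    FinSupp (w * Equiv.swap a b) := by
  refine (hw.union (Set.toFinite {a, b})).subset fun x hx => ?_
  by_contra h
  simp only [Set.mem_union, Set.mem_ofPred_eq, Set.mem_insert_iff, Set.mem_singleton_iff,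
    not_or, not_not] at h
  exact hx (by simp [Equiv.swap_apply_of_ne_of_ne h.2.1 h.2.2, h.1])

theorem eq_or_lt_or_gt (u : Equiv.Perm ℕ+) (x y : ℕ+) : x = y ∨ u x < u y ∨ u y < u x := by
  rcases lt_trichotomy (u x) (u y) with h | h | h
  · exact Or.inr (Or.inl h)
  · exact Or.inl (u.injective h)
  · exact Or.inr (Or.inr h)

/-- An injection from the inversions of `u` to those of `u * swap a b`, when `u a < u b`. -/
def inversionMap (a b : ℕ+) (p : ℕ+ × ℕ+) : ℕ+ × ℕ+ :=
  if Equiv.swap a b p.1 < Equiv.swap a b p.2 then (Equiv.swap a b p.1, Equiv.swap a b p.2) else p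

theorem injOn_inversionMap (a b : ℕ+) (u : Equiv.Perm ℕ+) :
    Set.InjOn (inversionMap a b) (inversions u) := by
  rintro ⟨p, q⟩ ⟨hpq, -⟩ ⟨p', q'⟩ ⟨hpq', -⟩ h
  simp only [inversionMap] at h hpq hpq'
  split_ifs at h with h₁ h₂ h₂
  · simpa using h
  · obtain ⟨rfl, rfl⟩ := Prod.mk.inj h
    simp [hpq] at h₂
  · obtain ⟨rfl, rfl⟩ := Prod.mk.inj h
    simp [hpq'] at h₁
  · exact h

theorem insert_image_inversionMap_subset {u : Equiv.Perm ℕ+} {a b : ℕ+} (hab : a < b)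
    (h : u a < u b) :
    insert (a, b) (inversionMap a b '' inversions u) ⊆ inversions (u * Equiv.swap a b) := by
  rintro x (rfl | ⟨⟨p, q⟩, ⟨hpq, hu⟩, rfl⟩)
  · exact ⟨hab, by simpa using h⟩
  · simp only at hpq hu
    simp only [inversionMap]
    split_ifs with hs
    · exact ⟨hs, by simpa using hu⟩
    · refine ⟨hpq, ?_⟩
      simp only [Equiv.Perm.mul_apply, Equiv.swap_apply_def] at hs ⊢
      grind

theorem notMem_image_inversionMap {u : Equiv.Perm ℕ+} {a b p q : ℕ+}
    (hs : ¬ Equiv.swap a b p < Equiv.swap a b q) (h : u p < u q) :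
    (p, q) ∉ inversionMap a b '' inversions u := by
  rintro ⟨⟨p', q'⟩, ⟨hpq, hu⟩, he⟩
  simp only [inversionMap] at he hpq hu
  split_ifs at he with hs'
  · obtain ⟨rfl, rfl⟩ := Prod.mk.inj he
    simp [hpq] at hs
  · obtain ⟨rfl, rfl⟩ := Prod.mk.inj he
    order

theorem ncard_insert_image_inversionMap {u : Equiv.Perm ℕ+} (hu : FinSupp u) {a b : ℕ+}
    (hab : a < b) (h : u a < u b) :
    (insert (a, b) (inversionMap a b '' inversions u)).ncard = len u + 1 := by
  rw [Set.ncard_insert_of_notMem (notMem_image_inversionMap (by simpa using hab.le) h)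
    (hu.finite_inversions.image _), (injOn_inversionMap a b u).ncard_image]
  rfl

theorem len_add_one_le {u : Equiv.Perm ℕ+} (hu : FinSupp u) {a b : ℕ+}
    (hab : a < b) (h : u a < u b) : len u + 1 ≤ len (u * Equiv.swap a b) := by
  rw [← ncard_insert_image_inversionMap hu hab h]
  exact Set.ncard_le_ncard (insert_image_inversionMap_subset hab h)
    (hu.mul_swap a b).finite_inversions

/-- The standard description of Bruhat covers. -/
theorem len_mul_swap_eq_iff {u : Equiv.Perm ℕ+} (hu : FinSupp u) {a b : ℕ+} (hab : a < b) :
    len (u * Equiv.swap a b) = len u + 1 ↔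
      u a < u b ∧ ∀ c, a < c → c < b → u a < u c → u b < u c := by
  constructor
  · intro hlen
    have h : u a < u b := by
      by_contra! h
      have := len_add_one_le (hu.mul_swap a b) hab
        (by simpa using lt_of_le_of_ne h (u.injective.ne hab.ne'))
      rw [mul_assoc, Equiv.swap_mul_self, mul_one] at this
      omega
    refine ⟨h, fun c hac hcb huc => ?_⟩
    by_contra! hcon
    have heq := Set.eq_of_subset_of_ncard_le (insert_image_inversionMap_subset hab h)
      (by rw [ncard_insert_image_inversionMap hu hab h, ← hlen]; rfl)
      (hu.mul_swap a b).finite_inversions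
    have hmem : (a, c) ∈ inversions (u * Equiv.swap a b) := by
      refine ⟨hac, ?_⟩
      have : u c ≠ u b := u.injective.ne hcb.ne
      simp only [Equiv.Perm.mul_apply, Equiv.swap_apply_left,
        Equiv.swap_apply_of_ne_of_ne hac.ne' hcb.ne]
      order
    rw [← heq] at hmem
    rcases hmem with hmem | hmem
    · exact hcb.ne (Prod.mk.inj hmem).2
    · refine notMem_image_inversionMap ?_ huc hmem
      rw [Equiv.swap_apply_left, Equiv.swap_apply_of_ne_of_ne hac.ne' hcb.ne]
      exact hcb.le.not_gt
  · rintro ⟨h, hc⟩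
    rw [← ncard_insert_image_inversionMap hu hab h]
    refine congrArg Set.ncard (Set.Subset.antisymm ?_ ?_ :
      inversions (u * Equiv.swap a b) = insert (a, b) (inversionMap a b '' inversions u))
    rotate_left
    · exact insert_image_inversionMap_subset hab h
    rintro ⟨p, q⟩ ⟨hpq, hv⟩
    simp only [Equiv.Perm.mul_apply] at hpq hv
    by_cases hs : Equiv.swap a b p < Equiv.swap a b q
    · exact Or.inr ⟨(Equiv.swap a b p, Equiv.swap a b q), ⟨hs, hv⟩, by simp [inversionMap, hpq]⟩
    · by_cases hpq' : (p, q) = (a, b)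
      · exact Or.inl hpq'
      · refine Or.inr ⟨(p, q), ⟨hpq, ?_⟩, by simp [inversionMap, hs]⟩
        have hinj : ∀ x y, x = y ∨ u x < u y ∨ u y < u x := eq_or_lt_or_gt u
        simp only [Equiv.swap_apply_def] at hs hv ⊢
        grind

/-- The pointwise criterion for comparability in the `k`-Bruhat order. -/
structure KBruhatCriterion (k : ℕ+) (u w : Equiv.Perm ℕ+) : Prop where
  le_of_le : ∀ a, a ≤ k → u a ≤ w a
  le_of_lt : ∀ b, k < b → w b ≤ u b
  lt_of_lt : ∀ p q, p < q → (q ≤ k ∨ k < p) → u p < u q → w p < w q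

theorem KBruhatCriterion.refl (k : ℕ+) (u : Equiv.Perm ℕ+) : KBruhatCriterion k u u :=
  ⟨fun _ _ => le_rfl, fun _ _ => le_rfl, fun _ _ _ _ h => h⟩

theorem KBruhatCriterion.trans {k : ℕ+} {u v w : Equiv.Perm ℕ+} (h : KBruhatCriterion k u v)
    (h' : KBruhatCriterion k v w) : KBruhatCriterion k u w :=
  ⟨fun a ha => (h.le_of_le a ha).trans (h'.le_of_le a ha),
    fun b hb => (h'.le_of_lt b hb).trans (h.le_of_lt b hb),
    fun p q hpq hk hlt => h'.lt_of_lt p q hpq hk (h.lt_of_lt p q hpq hk hlt)⟩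

theorem kBruhatCov.criterion {k : ℕ+} {u w : Equiv.Perm ℕ+} (hu : FinSupp u)
    (h : kBruhatCov k u w) : KBruhatCriterion k u w := by
  obtain ⟨a, b, ha, hb, rfl, hlen⟩ := h
  obtain ⟨hlt, hc⟩ := (len_mul_swap_eq_iff hu (ha.trans_lt hb)).1 hlen
  have hinj : ∀ x y, x = y ∨ u x < u y ∨ u y < u x := eq_or_lt_or_gt u
  constructor <;> simp only [Equiv.Perm.mul_apply, Equiv.swap_apply_def] <;> grind

theorem kBruhatCov.finSupp {k : ℕ+} {u w : Equiv.Perm ℕ+} (hu : FinSupp u)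
    (h : kBruhatCov k u w) : FinSupp w := by
  obtain ⟨a, b, -, -, rfl, -⟩ := h
  exact hu.mul_swap a b

theorem kBruhat.criterion {k : ℕ+} {u w : Equiv.Perm ℕ+} (hu : FinSupp u)
    (h : kBruhat k u w) : KBruhatCriterion k u w := by
  unfold kBruhat at h
  induction h using Relation.ReflTransGen.head_induction_on with
  | refl => exact .refl k w
  | head hcov _ ih => exact (hcov.criterion hu).trans (ih (hcov.finSupp hu))

theorem apply_mem_of_forall_apply_mem {u w : Equiv.Perm ℕ+} {S : Set ℕ+} (hS : S.Finite)
    (h : ∀ p, u p ∈ S → w p ∈ S) {p : ℕ+} (hp : w p ∈ S) : u p ∈ S := by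
  have hsub : u ⁻¹' S ⊆ w ⁻¹' S := h
  have heq := Set.eq_of_subset_of_ncard_le hsub
    (by rw [Set.ncard_preimage_of_injective_subset_range w.injective (by simp),
      Set.ncard_preimage_of_injective_subset_range u.injective (by simp)])
    (hS.preimage w.injective.injOn)
  change p ∈ u ⁻¹' S
  rw [heq]
  exact hp

theorem KBruhatCriterion.eq {k : ℕ+} {u w : Equiv.Perm ℕ+} (h : KBruhatCriterion k u w)
    (heq : ∀ a, a ≤ k → u a = w a) : u = w := by
  have hle : ∀ p, w p ≤ u p := fun p => by
    rcases le_or_gt p k with hp | hp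
    · exact (heq p hp).ge
    · exact h.le_of_lt p hp
  refine Equiv.ext fun p => le_antisymm ?_ (hle p)
  exact apply_mem_of_forall_apply_mem (S := Set.Iic (w p)) (Set.finite_Iic _)
    (fun q hq => (hle q).trans hq) (Set.mem_Iic.2 le_rfl)

/-- A pair satisfying the criterion admits a first cover in a chain. -/
theorem KBruhatCriterion.exists_cover {k : ℕ+} {u w : Equiv.Perm ℕ+} (hu : FinSupp u)
    (h : KBruhatCriterion k u w) (hne : u ≠ w) :
    ∃ a b, a ≤ k ∧ k < b ∧ u a < u b ∧ len (u * Equiv.swap a b) = len u + 1 ∧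
      KBruhatCriterion k (u * Equiv.swap a b) w := by
  obtain ⟨a₀, ha₀, hlt₀⟩ : ∃ a, a ≤ k ∧ u a < w a := by
    by_contra! hcon
    exact hne (h.eq fun a ha => le_antisymm (h.le_of_le a ha) (hcon a ha))
  obtain ⟨a, ⟨hak, haw⟩, hmax⟩ := Set.exists_max_image {a | a ≤ k ∧ u a < w a} u
    ((Set.finite_Iic k).subset fun a ha => ha.1) ⟨a₀, ha₀, hlt₀⟩
  have hfix : ∀ c, c ≤ k → u a < u c → u c = w c := fun c hc hac => by
    by_contra hcw
    exact (hmax c ⟨hc, lt_of_le_of_ne (h.le_of_le c hc) hcw⟩).not_gt hac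
  have hex : ∃ b, k < b ∧ w b ≤ u a ∧ u a < u b ∧ u b ≤ w a := by
    by_contra! hcon
    refine lt_irrefl (u a) (apply_mem_of_forall_apply_mem (w := w) (S := Set.Ioc (u a) (w a))
      (Set.finite_Ioc _ _) (fun p hp => ?_) ⟨haw, le_rfl⟩).1
    rcases le_or_gt p k with hpk | hpk
    · rwa [← hfix p hpk hp.1]
    · refine ⟨?_, (h.le_of_lt p hpk).trans hp.2⟩
      by_contra! hwp
      exact (hcon p hpk hwp hp.1).not_ge hp.2
  obtain ⟨b, ⟨hkb, hwb, hab, hba⟩, hmin⟩ := (InvImage.wf u wellFounded_lt).has_min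
    {b | k < b ∧ w b ≤ u a ∧ u a < u b ∧ u b ≤ w a} hex
  have hmin' : ∀ c, k < c → w c ≤ u a → u a < u c → u b ≤ u c := fun c h₁ h₂ h₃ => by
    by_contra! hcb
    exact hmin c ⟨h₁, h₂, h₃, hcb.le.trans hba⟩ hcb
  have hinj : ∀ x y, x = y ∨ u x < u y ∨ u y < u x := eq_or_lt_or_gt u
  obtain ⟨h₁, h₂, h₃⟩ := h
  refine ⟨a, b, hak, hkb, hab, (len_mul_swap_eq_iff hu (hak.trans_lt hkb)).2 ⟨hab, ?_⟩, ?_, ?_, ?_⟩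
  · intro c hac hcb huc
    by_contra! hcon
    have hne' : u c ≠ u b := u.injective.ne hcb.ne
    have hucb : u c < u b := lt_of_le_of_ne hcon hne'
    rcases le_or_gt c k with hck | hck
    · have := h₃ a c hac (Or.inl hck) huc
      have := hfix c hck huc
      order
    · have := h₃ c b hcb (Or.inr hck) hucb
      have := hmin' c hck (by order) huc
      order
  · simp only [Equiv.Perm.mul_apply, Equiv.swap_apply_def]
    grind
  · simp only [Equiv.Perm.mul_apply, Equiv.swap_apply_def]
    grind
  · simp only [Equiv.Perm.mul_apply, Equiv.swap_apply_def]
    grind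

theorem KBruhatCriterion.kBruhat {k : ℕ+} {u w : Equiv.Perm ℕ+} (hu : FinSupp u)
    (h : KBruhatCriterion k u w) : kBruhat k u w := by
  by_cases hne : u = w
  · exact hne ▸ Relation.ReflTransGen.refl
  · obtain ⟨a, b, ha, hb, hab, hlen, hcrit⟩ := h.exists_cover hu hne
    exact Relation.ReflTransGen.head ⟨a, b, ha, hb, rfl, hlen⟩
      (KBruhatCriterion.kBruhat (hu.mul_swap a b) hcrit)
termination_by ∑ c ∈ Finset.Iic k, ((w c : ℕ) - (u c : ℕ))
decreasing_by
  have hva : (u * Equiv.swap a b) a = u b := by simp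
  have hle := hcrit.le_of_le a ha
  rw [hva] at hle
  refine Finset.sum_lt_sum (fun c hc => ?_) ⟨a, Finset.mem_Iic.2 ha, ?_⟩
  · rcases eq_or_ne c a with rfl | hca
    · rw [hva]
      exact Nat.sub_le_sub_left (PNat.coe_le_coe _ _ |>.2 hab.le) _
    · have hcb : c ≠ b := ((Finset.mem_Iic.1 hc).trans_lt hb).ne
      simp [Equiv.swap_apply_of_ne_of_ne hca hcb]
  · rw [hva]
    rw [← PNat.coe_lt_coe] at hab
    rw [← PNat.coe_le_coe] at hle
    omega

/-- Key lemma: if `u ⋖_k (α,β)u ≤_k w`, `y ≤_k z` and `w u⁻¹ = z y⁻¹`, then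
`y ⋖_k (α,β)y ≤_k z`.  Here `(α,β)u = (swap α β) * u`. -/
theorem stmt_4 (k : ℕ+) (α β : ℕ+) (hαβ : α < β) (u w y z : Equiv.Perm ℕ+)
    (hu : FinSupp u) (hw : FinSupp w) (hy : FinSupp y) (hz : FinSupp z)
    (h₁ : kBruhatCov k u (Equiv.swap α β * u))
    (h₂ : kBruhat k (Equiv.swap α β * u) w)
    (h₃ : kBruhat k y z)
    (h₄ : w * u⁻¹ = z * y⁻¹) :
    kBruhatCov k y (Equiv.swap α β * y) ∧ kBruhat k (Equiv.swap α β * y) z := by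
  have hcu := h₂.criterion (h₁.finSupp hu)
  have hcuw := (h₁.criterion hu).trans hcu
  have hcy := h₃.criterion hy
  obtain ⟨a, b, ha, hb, hswap, hlen⟩ := h₁
  rw [hswap] at hcu
  rw [hswap] at hlen
  obtain ⟨hlt, hbtw⟩ := (len_mul_swap_eq_iff hu (ha.trans_lt hb)).1 hlen
  obtain ⟨rfl, rfl⟩ : u a = α ∧ u b = β := by
    have e₁ := congrArg (fun f : Equiv.Perm ℕ+ => f a) hswap
    have e₂ := congrArg (fun f : Equiv.Perm ℕ+ => f b) hswap
    simp only [Equiv.Perm.mul_apply, Equiv.swap_apply_left, Equiv.swap_apply_right,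
      Equiv.swap_apply_def] at e₁ e₂
    grind
  obtain ⟨a', ha'⟩ := y.surjective (u a)
  obtain ⟨b', hb'⟩ := y.surjective (u b)
  have hζ : ∀ p q, u p = y q → w p = z q := fun p q hpq => by
    have := congrArg (fun f : Equiv.Perm ℕ+ => f (y q)) h₄
    have hp : u⁻¹ (y q) = p := by rw [← hpq]; exact u.symm_apply_apply p
    have hq : y⁻¹ (y q) = q := y.symm_apply_apply q
    simpa only [Equiv.Perm.mul_apply, hp, hq] using this
  have hwa : u b ≤ w a := by simpa using hcu.le_of_le a ha
  have hwb : w b ≤ u a := by simpa using hcu.le_of_lt b hb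
  have hza := hζ a a' ha'.symm
  have hzb := hζ b b' hb'.symm
  have ha'k : a' ≤ k := by
    by_contra! hk
    have := hcy.le_of_lt a' hk
    order
  have hb'k : k < b' := by
    by_contra! hk
    have := hcy.le_of_le b' hk
    order
  -- values strictly between `α` and `β` keep their order relative to `z a'`, resp. `z b'`
  have hlow : ∀ c, y a' < y c → y c < y b' → z c ≤ z a' := fun c hac hcb => by
    obtain ⟨d, hd⟩ := u.surjective (y c)
    have hzd := hζ d c hd
    by_contra! hcon
    have hdk : d ≤ k := by
      by_contra! hk
      have := hcuw.le_of_lt d hk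
      order
    have hda : d < a := by
      by_contra! had
      have hne : a ≠ d := by rintro rfl; order
      have := hbtw d (lt_of_le_of_ne had hne) (hdk.trans_lt hb) (by order)
      order
    have := hcu.lt_of_lt d a hda (Or.inl ha) (by
      rw [Equiv.Perm.mul_apply, Equiv.Perm.mul_apply, Equiv.swap_apply_left,
        Equiv.swap_apply_of_ne_of_ne hda.ne (hdk.trans_lt hb).ne]
      order)
    order
  have hhigh : ∀ c, y a' < y c → y c < y b' → z b' ≤ z c := fun c hac hcb => by
    obtain ⟨d, hd⟩ := u.surjective (y c)
    have hzd := hζ d c hd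
    by_contra! hcon
    have hdk : k < d := by
      by_contra! hk
      have := hcuw.le_of_le d hk
      order
    have hbd : b < d := by
      by_contra! had
      have hne : d ≠ b := by rintro rfl; order
      have := hbtw d (ha.trans_lt hdk) (lt_of_le_of_ne had hne) (by order)
      order
    have := hcu.lt_of_lt b d hbd (Or.inr hb) (by
      rw [Equiv.Perm.mul_apply, Equiv.Perm.mul_apply, Equiv.swap_apply_right,
        Equiv.swap_apply_of_ne_of_ne (ha.trans_lt hdk).ne' hbd.ne']
      order)
    order
  have hinj : ∀ p q, p = q ∨ y p < y q ∨ y q < y p := eq_or_lt_or_gt y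
  have hinjz : ∀ p q, p = q ∨ z p < z q ∨ z q < z p := eq_or_lt_or_gt z
  rw [← ha', ← hb', ← Equiv.mul_swap_eq_swap_mul]
  obtain ⟨g₁, g₂, g₃⟩ := hcy
  constructor
  · refine ⟨a', b', ha'k, hb'k, rfl, (len_mul_swap_eq_iff hy (ha'k.trans_lt hb'k)).2
      ⟨by order, fun c hac hcb huc => ?_⟩⟩
    by_contra! hcon
    have hcb' : y c < y b' := lt_of_le_of_ne hcon (y.injective.ne hcb.ne)
    have := hlow c huc hcb'
    have := hhigh c huc hcb'
    rcases le_or_gt c k with hck | hck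
    · have := g₃ a' c hac (Or.inl hck) huc
      order
    · have := g₃ c b' hcb (Or.inr hck) hcb'
      order
  · clear hcu hcuw h₂ h₃ h₄ hlen hbtw hswap
    have hyab : y a' < y b' := by order
    have hzA : y b' ≤ z a' := by order
    have hzB : z b' ≤ y a' := by order
    clear hwa hwb hza hzb hζ ha' hb' hlt hαβ
    refine KBruhatCriterion.kBruhat (hy.mul_swap a' b') ⟨?_, ?_, ?_⟩
    · simp only [Equiv.Perm.mul_apply, Equiv.swap_apply_def]
      grind
    · simp only [Equiv.Perm.mul_apply, Equiv.swap_apply_def]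
      grind
    · simp only [Equiv.Perm.mul_apply, Equiv.swap_apply_def]
      grind
end

section
/- Let ζ ∈ S_∞, and suppose u ≤_k ζu and x ≤_l ζx for some u, x ∈ S_∞ and k, l ∈ ℕ. Then ℓ(ζu) − ℓ(u) = ℓ(ζx) − ℓ(x). (Hence the rank |ζ| := ℓ(ζu) − ℓ(u) is well defined, independent of the choice of u and k with u ≤_k ζu.) -/
theorem FinSupp.exists_bound {w : Equiv.Perm ℕ+} (hw : FinSupp w) :
    ∃ N : ℕ+, ∀ i, N < i → w i = i := by
  obtain ⟨N, hN⟩ := Set.Finite.bddAbove hw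
  exact ⟨N, fun i hi => by_contra fun h => absurd (hN h) (not_le.mpr hi)⟩

theorem le_of_inversion {w : Equiv.Perm ℕ+} {N i j : ℕ+} (hN : ∀ i, N < i → w i = i)
    (hij : i < j) (hw : w j < w i) : j ≤ N := by
  by_contra! hj
  have h₁ := hN j hj
  rw [h₁] at hw
  have h₂ := w.injective (hN (w i) (hj.trans hw))
  rw [h₂] at hw
  exact lt_asymm hij hw

theorem FinSupp.finite_inversions_s7 {w : Equiv.Perm ℕ+} (hw : FinSupp w) :
    {p : ℕ+ × ℕ+ | p.1 < p.2 ∧ w p.2 < w p.1}.Finite := by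
  obtain ⟨N, hN⟩ := hw.exists_bound
  refine ((Set.finite_Iic N).prod (Set.finite_Iic N)).subset ?_
  rintro ⟨i, j⟩ ⟨hij, h⟩
  have hj := le_of_inversion hN hij h
  exact ⟨hij.le.trans hj, hj⟩

theorem FinSupp.mul {v w : Equiv.Perm ℕ+} (hv : FinSupp v) (hw : FinSupp w) :
    FinSupp (v * w) := by
  refine (Set.Finite.union hv hw).subset ?_
  intro i hi
  by_contra! h
  simp only [Set.mem_union, Set.mem_ofPred_eq, not_or, not_not] at h
  exact hi (by simp [h.1, h.2])

theorem finSupp_swap (a b : ℕ+) : FinSupp (Equiv.swap a b) := by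
  refine (Set.toFinite {a, b}).subset ?_
  intro i hi
  by_contra! h
  simp only [Set.mem_insert_iff, Set.mem_singleton_iff, not_or] at h
  exact hi (Equiv.swap_apply_of_ne_of_ne h.1 h.2)

/-- The sign recording whether `u` lists the value `α` before the value `β`. -/
def orderSign (u : Equiv.Perm ℕ+) (α β : ℕ+) : ℤ := if u⁻¹ α < u⁻¹ β then 1 else -1

/-- Left multiplication by `ζ` changes the length by a signed count of the inversions of `ζ`. -/
theorem len_mul_sub_len {ζ u : Equiv.Perm ℕ+} (hζ : FinSupp ζ) (hu : FinSupp u) (F : Finset ℕ+)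
    (hF : ∀ α β, α < β → ζ β < ζ α → α ∈ F ∧ β ∈ F) :
    (len (ζ * u) : ℤ) - len u =
      ∑ α ∈ F, ∑ β ∈ F, if α < β ∧ ζ β < ζ α then orderSign u α β else 0 := by
  set S := {p : ℕ+ × ℕ+ | p.1 < p.2 ∧ (ζ * u) p.2 < (ζ * u) p.1} with hS
  set T := {p : ℕ+ × ℕ+ | p.1 < p.2 ∧ u p.2 < u p.1} with hT
  have hSfin : S.Finite := (hζ.mul hu).finite_inversions_s7
  have hTfin : T.Finite := hu.finite_inversions_s7
  have hlS : len (ζ * u) = S.ncard := rfl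
  have hlT : len u = T.ncard := rfl
  have h₁ := Set.ncard_inter_add_ncard_sdiff_eq_ncard S T hSfin
  have h₂ := Set.ncard_inter_add_ncard_sdiff_eq_ncard T S hTfin
  rw [Set.inter_comm] at h₂
  have hpos : (S \ T).ncard =
      ((F ×ˢ F).filter fun p => (p.1 < p.2 ∧ ζ p.2 < ζ p.1) ∧ u⁻¹ p.1 < u⁻¹ p.2).card := by
    rw [← Set.ncard_coe_finset]
    refine Set.ncard_congr (fun p _ => (u p.1, u p.2)) ?_ ?_ ?_
    · rintro ⟨i, j⟩ ⟨⟨hij, h⟩, h'⟩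
      simp only [hT, Set.mem_ofPred_eq, not_and, not_lt] at h'
      have hlt : u i < u j := lt_of_le_of_ne (h' hij) (u.injective.ne hij.ne)
      have := hF _ _ hlt h
      simp only [Finset.coe_filter, Finset.mem_product, Set.mem_ofPred_eq]
      refine ⟨this, ⟨hlt, h⟩, by simpa using hij⟩
    · rintro ⟨i, j⟩ ⟨i', j'⟩ _ _ h
      simpa using h
    · rintro ⟨α, β⟩ h
      simp only [Finset.coe_filter, Finset.mem_product, Set.mem_ofPred_eq] at h
      obtain ⟨-, ⟨h₁, h₂⟩, h₃⟩ := h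
      refine ⟨(u⁻¹ α, u⁻¹ β), ⟨⟨h₃, by simpa using h₂⟩, ?_⟩, by simp⟩
      simp only [hT, Set.mem_ofPred_eq, not_and, not_lt]
      intro _
      simpa using h₁.le
  have hneg : (T \ S).ncard =
      ((F ×ˢ F).filter fun p => (p.1 < p.2 ∧ ζ p.2 < ζ p.1) ∧ ¬ u⁻¹ p.1 < u⁻¹ p.2).card := by
    rw [← Set.ncard_coe_finset]
    refine Set.ncard_congr (fun p _ => (u p.2, u p.1)) ?_ ?_ ?_
    · rintro ⟨i, j⟩ ⟨⟨hij, h⟩, h'⟩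
      simp only [hS, Set.mem_ofPred_eq, not_and, not_lt] at h'
      have hlt : ζ (u i) < ζ (u j) :=
        lt_of_le_of_ne (h' hij) (ζ.injective.ne (u.injective.ne hij.ne))
      have := hF _ _ h hlt
      simp only [Finset.coe_filter, Finset.mem_product, Set.mem_ofPred_eq]
      refine ⟨this, ⟨h, hlt⟩, by simpa using hij.le⟩
    · rintro ⟨i, j⟩ ⟨i', j'⟩ _ _ h
      simpa [and_comm] using h
    · rintro ⟨α, β⟩ h
      simp only [Finset.coe_filter, Finset.mem_product, Set.mem_ofPred_eq] at h
      obtain ⟨-, ⟨h₁, h₂⟩, h₃⟩ := h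
      have h₄ : u⁻¹ β < u⁻¹ α :=
        lt_of_le_of_ne (not_lt.mp h₃) ((u⁻¹).injective.ne h₁.ne')
      refine ⟨(u⁻¹ β, u⁻¹ α), ⟨⟨h₄, by simpa using h₁⟩, ?_⟩, by simp⟩
      simp only [hS, Set.mem_ofPred_eq, not_and, not_lt]
      intro _
      simpa using h₂.le
  have hsum : (∑ α ∈ F, ∑ β ∈ F, if α < β ∧ ζ β < ζ α then orderSign u α β else 0) =
      ((S \ T).ncard : ℤ) - (T \ S).ncard := by
    rw [hpos, hneg, Finset.card_filter, Finset.card_filter, ← Finset.sum_product']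
    push_cast
    rw [← Finset.sum_sub_distrib]
    refine Finset.sum_congr rfl fun p _ => ?_
    unfold orderSign
    by_cases h : p.1 < p.2 ∧ ζ p.2 < ζ p.1 <;> by_cases h' : u⁻¹ p.1 < u⁻¹ p.2 <;>
      simp only [h, h', and_self, and_true, and_false, not_true_eq_false, not_false_eq_true,
        if_true, if_false] <;> norm_num
  rw [hsum, hlS, hlT]
  omega

/-- The effect on the length of exchanging the values `α < β`. -/
theorem len_swap_mul_sub_len {u : Equiv.Perm ℕ+} (hu : FinSupp u) {α β : ℕ+} (h : α < β) :
    (len (Equiv.swap α β * u) : ℤ) - len u =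
      orderSign u α β + ∑ γ ∈ Finset.Ioo α β, (orderSign u α γ + orderSign u γ β) := by
  have key : ∀ γ δ : ℕ+, γ < δ ∧ Equiv.swap α β δ < Equiv.swap α β γ ↔
      (γ = α ∧ α < δ ∧ δ ≤ β) ∨ (δ = β ∧ α < γ ∧ γ < β) := by
    intro γ δ
    simp only [Equiv.swap_apply_def]
    split_ifs <;> subst_vars <;> constructor <;> intro h <;> grind
  rw [len_mul_sub_len (finSupp_swap α β) hu (Finset.Icc α β)]
  · have hterm : ∀ γ ∈ Finset.Icc α β, ∀ δ ∈ Finset.Icc α β,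
        (if γ < δ ∧ Equiv.swap α β δ < Equiv.swap α β γ then orderSign u γ δ else 0) =
          (if γ = α then (if δ = β then orderSign u α β else 0) else 0) +
          (if γ = α then (if α < δ ∧ δ < β then orderSign u α δ else 0) else 0) +
          (if δ = β then (if α < γ ∧ γ < β then orderSign u γ β else 0) else 0) := by
      intro γ hγ δ hδ
      rw [if_congr (key γ δ) rfl rfl]
      grind
    have hIoo : Finset.Ioo α β = (Finset.Icc α β).filter fun γ => α < γ ∧ γ < β := by
      ext γ
      simp only [Finset.mem_Ioo, Finset.mem_filter, Finset.mem_Icc]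
      exact ⟨fun h => ⟨⟨h.1.le, h.2.le⟩, h⟩, fun h => h.2⟩
    rw [Finset.sum_congr rfl fun γ hγ => Finset.sum_congr rfl (hterm γ hγ)]
    simp only [Finset.sum_add_distrib]
    rw [hIoo, Finset.sum_filter, Finset.sum_filter, add_assoc]
    congr 1
    · simp [h.le]
    · congr 1
      · rw [Finset.sum_comm]
        simp [h.le]
      · simp [h.le]
  · intro γ δ h₁ h₂
    have := (key γ δ).mp ⟨h₁, h₂⟩
    simp only [Finset.mem_Icc]
    grind

/-- A cover in the `k`-Bruhat order raises the entry in the earlier position, and no entry in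
between has an intermediate value. -/
theorem lt_and_of_len_mul_swap {u : Equiv.Perm ℕ+} (hu : FinSupp u) {a b : ℕ+} (hab : a < b)
    (h : len (u * Equiv.swap a b) = len u + 1) :
    u a < u b ∧ ∀ c, a < c → c < b → u a < u c → ¬ u c < u b := by
  rw [Equiv.mul_swap_eq_swap_mul] at h
  have sign_pos {α β : ℕ+} : u⁻¹ α < u⁻¹ β → orderSign u α β = 1 := fun h => if_pos h
  have sign_neg {α β : ℕ+} : u⁻¹ β ≤ u⁻¹ α → orderSign u α β = -1 :=
    fun h => if_neg (not_lt.mpr h)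
  have sign_or (α β : ℕ+) : orderSign u α β = 1 ∨ orderSign u α β = -1 := by
    unfold orderSign
    split_ifs <;> simp
  have ha : u⁻¹ (u a) = a := u.symm_apply_apply a
  have hb : u⁻¹ (u b) = b := u.symm_apply_apply b
  rcases lt_or_gt_of_ne (u.injective.ne hab.ne) with hlt | hgt
  · refine ⟨hlt, fun c hac hcb h₁ h₂ => ?_⟩
    have hc : u⁻¹ (u c) = c := u.symm_apply_apply c
    have hlen := len_swap_mul_sub_len hu hlt
    rw [sign_pos (by rwa [ha, hb])] at hlen
    have hle := Finset.single_le_sum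
      (f := fun γ => orderSign u (u a) γ + orderSign u γ (u b)) (fun γ _ => by
        rcases lt_or_ge a (u⁻¹ γ) with h | h
        · have := sign_pos (α := u a) (β := γ) (by rwa [ha])
          have := sign_or γ (u b)
          lia
        · have := sign_pos (α := γ) (β := u b) (by rw [hb]; exact h.trans_lt hab)
          have := sign_or (u a) γ
          lia) (Finset.mem_Ioo.mpr ⟨h₁, h₂⟩)
    simp only [sign_pos (α := u a) (β := u c) (by rwa [ha, hc]),
      sign_pos (α := u c) (β := u b) (by rwa [hc, hb])] at hle
    lia
  · exfalso
    rw [Equiv.swap_comm] at h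
    have hlen := len_swap_mul_sub_len hu hgt
    rw [sign_neg (by rw [ha, hb]; exact hab.le)] at hlen
    have hle := Finset.sum_nonpos (s := Finset.Ioo (u b) (u a))
      (f := fun γ => orderSign u (u b) γ + orderSign u γ (u a)) (fun γ _ => by
        rcases le_or_gt a (u⁻¹ γ) with h | h
        · have := sign_neg (α := γ) (β := u a) (by rwa [ha])
          have := sign_or (u b) γ
          lia
        · have := sign_neg (α := u b) (β := γ) (by rw [hb]; exact (h.trans hab).le)
          have := sign_or γ (u a)
          lia)
    lia

/-- The necessary conditions for `u ≤_k w`. -/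
theorem kBruhat.necessary {k : ℕ+} {u w : Equiv.Perm ℕ+} (hu : FinSupp u) (h : kBruhat k u w) :
    (∀ i ≤ k, u i ≤ w i) ∧ (∀ i, k < i → w i ≤ u i) ∧
      ∀ i j, i < j → (j ≤ k ∨ k < i) → u i < u j → w i < w j := by
  suffices FinSupp w ∧ (∀ i ≤ k, u i ≤ w i) ∧ (∀ i, k < i → w i ≤ u i) ∧
      ∀ i j, i < j → (j ≤ k ∨ k < i) → u i < u j → w i < w j from this.2
  induction h with
  | refl => exact ⟨hu, fun _ _ => le_rfl, fun _ _ => le_rfl, fun _ _ _ _ h => h⟩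
  | tail _ hc ih =>
    rename_i v w _
    obtain ⟨a, b, hak, hkb, rfl, hlen⟩ := hc
    obtain ⟨hv, h₁, h₂, h₃⟩ := ih
    obtain ⟨hlt, hbtw⟩ := lt_and_of_len_mul_swap hv (hak.trans_lt hkb) hlen
    refine ⟨hv.mul (finSupp_swap a b), ?_, ?_, ?_⟩
    · intro i hi
      have := h₁ i hi
      simp only [Equiv.Perm.mul_apply, Equiv.swap_apply_def]
      grind
    · intro i hi
      have := h₂ i hi
      simp only [Equiv.Perm.mul_apply, Equiv.swap_apply_def]
      grind
    · intro i j hij hk huij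
      have := h₃ i j hij hk huij
      have hi := hbtw i
      have hj := hbtw j
      have hne₁ : v j ≠ v b ∨ j = b := by
        simpa using ne_or_eq j b
      have hne₂ : v i ≠ v a ∨ i = a := by
        simpa using ne_or_eq i a
      simp only [Equiv.Perm.mul_apply, Equiv.swap_apply_def]
      grind

/-- The block, `+1` for positions at most `k` and `-1` for later ones, in which `u` has the
value `α`. -/
def blockSign (k : ℕ+) (u : Equiv.Perm ℕ+) (α : ℕ+) : ℤ := if u⁻¹ α ≤ k then 1 else -1

theorem kBruhat.orderSign_eq {k : ℕ+} {ζ u : Equiv.Perm ℕ+} (hu : FinSupp u)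
    (h : kBruhat k u (ζ * u)) {α β : ℕ+} (hαβ : α < β) (hζ : ζ β < ζ α) :
    orderSign u α β = -(blockSign k u α * blockSign k u β) := by
  obtain ⟨h₁, h₂, h₃⟩ := h.necessary hu
  have a₁ := h₁ (u⁻¹ α)
  have a₂ := h₂ (u⁻¹ α)
  have b₁ := h₁ (u⁻¹ β)
  have b₂ := h₂ (u⁻¹ β)
  have c := h₃ (u⁻¹ α) (u⁻¹ β)
  have hα : u (u⁻¹ α) = α := u.apply_symm_apply α
  have hβ : u (u⁻¹ β) = β := u.apply_symm_apply β
  simp only [Equiv.Perm.mul_apply, hα, hβ] at a₁ a₂ b₁ b₂ c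
  clear h₁ h₂ h₃
  unfold orderSign blockSign
  grind

theorem kBruhat.blockSign_eq {k : ℕ+} {ζ u : Equiv.Perm ℕ+} (hu : FinSupp u)
    (h : kBruhat k u (ζ * u)) {α : ℕ+} (hα : ζ α ≠ α) :
    blockSign k u α = if α < ζ α then 1 else -1 := by
  obtain ⟨h₁, h₂, -⟩ := h.necessary hu
  have a₁ := h₁ (u⁻¹ α)
  have a₂ := h₂ (u⁻¹ α)
  have hu' : u (u⁻¹ α) = α := u.apply_symm_apply α
  simp only [Equiv.Perm.mul_apply, hu'] at a₁ a₂
  clear h₁ h₂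
  unfold blockSign
  grind

/-- The direction in which `ζ` moves `α`. -/
def moveSign (ζ : Equiv.Perm ℕ+) (α : ℕ+) : ℤ :=
  if ζ α = α then 0 else if α < ζ α then 1 else -1

/-- As many points jump up over a fixed point as jump down over it. -/
theorem sum_moveSign_inversions_eq_zero {ζ : Equiv.Perm ℕ+} {F : Finset ℕ+}
    (hF : {α | ζ α ≠ α} ⊆ (F : Set ℕ+)) {γ : ℕ+} (hγ : ζ γ = γ) :
    ∑ β ∈ F, moveSign ζ β * ((if β < γ ∧ ζ γ < ζ β then 1 else 0) +
      if γ < β ∧ ζ β < ζ γ then 1 else 0) = 0 := by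
  have h := ζ.sum_comp F (fun β => if β < γ then (1 : ℤ) else 0) hF
  rw [eq_comm, ← sub_eq_zero, ← Finset.sum_sub_distrib] at h
  rw [← h]
  refine Finset.sum_congr rfl fun β _ => ?_
  have h₁ : ζ β = γ → β = γ := fun h => ζ.injective (h.trans hγ.symm)
  unfold moveSign
  rw [hγ]
  grind

/-- If `u ≤_k ζu`, then `ℓ(ζu) - ℓ(u)` is given by a formula involving `ζ` only. -/
theorem kBruhat.len_sub_len {k N : ℕ+} {ζ u : Equiv.Perm ℕ+} (hζ : FinSupp ζ) (hu : FinSupp u)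
    (h : kBruhat k u (ζ * u)) (hN : ∀ i, N < i → ζ i = i) :
    (len (ζ * u) : ℤ) - len u = ∑ α ∈ Finset.Iic N, ∑ β ∈ Finset.Iic N,
      if α < β ∧ ζ β < ζ α then -(moveSign ζ α * moveSign ζ β) else 0 := by
  set F := Finset.Iic N
  have hF : {α | ζ α ≠ α} ⊆ (F : Set ℕ+) := fun α hα => by
    by_contra hn
    exact hα (hN α (by simpa [F] using hn))
  rw [len_mul_sub_len hζ hu F]
  · set d : ℕ+ → ℤ := fun γ => if ζ γ = γ then blockSign k u γ else 0 with hd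
    have hterm : ∀ α β : ℕ+, (if α < β ∧ ζ β < ζ α then orderSign u α β else 0) =
        (if α < β ∧ ζ β < ζ α then -(moveSign ζ α * moveSign ζ β) else 0) -
        (d α * (moveSign ζ β * if α < β ∧ ζ β < ζ α then 1 else 0) +
          d β * (moveSign ζ α * if α < β ∧ ζ β < ζ α then 1 else 0)) := by
      intro α β
      by_cases hi : α < β ∧ ζ β < ζ α
      · have hα := h.blockSign_eq hu (α := α)
        have hβ := h.blockSign_eq hu (α := β)
        have hne : ¬ (ζ α = α ∧ ζ β = β) := fun ⟨h₁, h₂⟩ => by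
          rw [h₁, h₂] at hi
          exact lt_asymm hi.1 hi.2
        simp only [if_pos hi, h.orderSign_eq hu hi.1 hi.2, hd, moveSign]
        by_cases h₁ : ζ α = α <;> by_cases h₂ : ζ β = β
        · exact absurd ⟨h₁, h₂⟩ hne
        · simp [h₁, h₂, hβ h₂]
        · simp [h₁, h₂, hα h₁, mul_comm]
        · simp [h₁, h₂, hα h₁, hβ h₂]
      · simp [hi]
    simp only [hterm, Finset.sum_sub_distrib, Finset.sum_add_distrib]
    rw [sub_eq_self, Finset.sum_comm (f := fun α β =>
      d β * (moveSign ζ α * if α < β ∧ ζ β < ζ α then 1 else 0)), ← Finset.sum_add_distrib]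
    refine Finset.sum_eq_zero fun γ _ => ?_
    rw [← Finset.mul_sum, ← Finset.mul_sum, ← mul_add, ← Finset.sum_add_distrib]
    by_cases hγ : ζ γ = γ
    · refine mul_eq_zero_of_right _ (Eq.trans ?_ (sum_moveSign_inversions_eq_zero hF hγ))
      refine Finset.sum_congr rfl fun β _ => ?_
      ring
    · simp [hd, hγ]
  · intro α β h₁ h₂
    have hβ := le_of_inversion hN h₁ h₂
    exact ⟨Finset.mem_Iic.mpr (h₁.le.trans hβ), Finset.mem_Iic.mpr hβ⟩

/-- If `u ≤_k ζu` and `x ≤_l ζx`, then `ℓ(ζu) - ℓ(u) = ℓ(ζx) - ℓ(x)`; hence the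
rank `|ζ| := ℓ(ζu) - ℓ(u)` is well defined. -/
theorem stmt_7 (ζ u x : Equiv.Perm ℕ+) (k l : ℕ+)
    (hζ : FinSupp ζ) (hu : FinSupp u) (hx : FinSupp x)
    (h₁ : kBruhat k u (ζ * u)) (h₂ : kBruhat l x (ζ * x)) :
    (len (ζ * u) : ℤ) - (len u : ℤ) = (len (ζ * x) : ℤ) - (len x : ℤ) := by
  obtain ⟨N, hN⟩ := hζ.exists_bound
  rw [h₁.len_sub_len hζ hu hN, h₂.len_sub_len hζ hx hN]
end
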